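/- arXiv:1508.00664 — 2 statements merged into one kernel-verified Lean document; each statement's English description precedes it below -/
import Mathlib

section
/- For λ > λ' > 0, the function P ↦ log(1+Pλ²) − log(1+Pλ'²) on P ≥ 0 is strictly concave. -/
theorem hasDerivAt_log_one_add_mul_sub {a b x : ℝ} (ha : 1 + x * a ≠ 0) (hb : 1 + x * b ≠ 0) :
    HasDerivAt (fun P : ℝ => Real.log (1 + P * a) - Real.log (1 + P * b))
      ((a - b) / ((1 + x * a) * (1 + x * b))) x := by
  have key (c : ℝ) (hc : 1 + x * c ≠ 0) :
      HasDerivAt (fun P : ℝ => Real.log (1 + P * c)) (c / (1 + x * c)) x := by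
    have hlin : HasDerivAt (fun P : ℝ => 1 + P * c) c x := by
      simpa using ((hasDerivAt_id x).mul_const c).const_add 1
    exact hlin.log hc
  refine ((key a ha).sub (key b hb)).congr_deriv ?_
  rw [div_sub_div _ _ ha hb]
  ring

theorem strictConcaveOn_log_one_add_mul_sub {a b : ℝ} (hb : 0 < b) (hab : b < a) :
    StrictConcaveOn ℝ (Set.Ici 0)
      (fun P : ℝ => Real.log (1 + P * a) - Real.log (1 + P * b)) := by
  have ha : 0 < a := hb.trans hab
  have hderiv {x : ℝ} (hx : 0 ≤ x) :=
    hasDerivAt_log_one_add_mul_sub (a := a) (b := b) (x := x) (by positivity) (by positivity)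
  refine StrictAntiOn.strictConcaveOn_of_deriv (convex_Ici 0)
    (fun x hx => (hderiv hx).continuousAt.continuousWithinAt) ?_
  rw [interior_Ici]
  intro x hx y hy hxy
  rw [Set.mem_Ioi] at hx hy
  rw [(hderiv hx.le).deriv, (hderiv hy.le).deriv]
  have hpos : 0 < a - b := sub_pos.mpr hab
  gcongr

/-- For `λ > λ' > 0`, the map `P ↦ log(1+Pλ²) − log(1+Pλ'²)` is strictly
concave on `P ≥ 0`. -/
theorem stmt10 (lam lam' : ℝ) (h' : 0 < lam') (h : lam' < lam) :
    StrictConcaveOn ℝ (Set.Ici 0)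
      (fun P : ℝ => Real.log (1 + P * lam ^ 2) - Real.log (1 + P * lam' ^ 2)) :=
  strictConcaveOn_log_one_add_mul_sub (by positivity) (by gcongr)
end

section
/- Let (γ₀, γ₁) have joint density e^{−(γ₀+γ₁)}(γ₀−γ₁)² on the region γ₀ > γ₁ > 0 (ordered eigenvalues of a 2×2 complex Wishart matrix). Then E[log(γ₀/γ₁)] = 1 + 2·ln 2, i.e., ∫₀^∞ ∫₀^{γ₀} log(γ₀/γ₁) e^{−(γ₀+γ₁)}(γ₀−γ₁)² dγ₁ dγ₀ = 1 + 2 ln 2. -/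
open MeasureTheory

/-- The Gamma integral `∫₀^∞ x³ e^{−rx} dx = 6 / r⁴`. -/
lemma integral_pow_three_mul_exp_neg_mul {r : ℝ} (hr : 0 < r) :
    ∫ x in Set.Ioi (0 : ℝ), x ^ 3 * Real.exp (-(r * x)) = 6 / r ^ 4 := by
  have h := Real.integral_rpow_mul_exp_neg_mul_Ioi (a := (4 : ℕ)) (r := r) (by norm_num) hr
  have hg : Real.Gamma ((4 : ℕ) : ℝ) = 6 := by
    have := Real.Gamma_nat_eq_factorial 3
    norm_num [Nat.factorial] at this ⊢
  rw [hg, Real.rpow_natCast] at h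
  have he : ((4 : ℕ) : ℝ) - 1 = (3 : ℕ) := by norm_num
  simp only [he, Real.rpow_natCast] at h
  rw [h]
  field_simp

lemma integrableOn_pow_three_mul_exp_neg_mul {r : ℝ} (hr : 0 < r) :
    IntegrableOn (fun x : ℝ => x ^ 3 * Real.exp (-(r * x))) (Set.Ioi 0) := by
  by_contra h
  have h0 := integral_undef h
  rw [integral_pow_three_mul_exp_neg_mul hr] at h0
  exact ne_of_gt (div_pos (by norm_num : (0 : ℝ) < 6) (pow_pos hr 4)) h0

/-- An antiderivative of `−6 log t (1−t)² / (1+t)⁴` that is continuous on `[0, 1]`. -/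
noncomputable def logRatioPrimitive (t : ℝ) : ℝ :=
  -(t * Real.log t) * ((6 + 2 * t ^ 2) / (1 + t) ^ 3) - ((1 - t) / (1 + t)) ^ 2
    + 2 * Real.log (1 + t)

lemma hasDerivAt_logRatioPrimitive {t : ℝ} (ht : 0 < t) :
    HasDerivAt logRatioPrimitive (-Real.log t * (1 - t) ^ 2 * (6 / (1 + t) ^ 4)) t := by
  have h1 : 1 + t ≠ 0 := by positivity
  have hs : HasDerivAt (fun t : ℝ => 1 + t) 1 t := (hasDerivAt_id t).const_add 1
  have hm : HasDerivAt (fun t : ℝ => 1 - t) (-1) t := (hasDerivAt_id t).const_sub 1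
  have hn : HasDerivAt (fun t : ℝ => 6 + 2 * t ^ 2) (2 * (2 * t)) t := by
    simpa using ((hasDerivAt_pow 2 t).const_mul 2).const_add 6
  have := (((Real.hasDerivAt_mul_log ht.ne').neg.mul (hn.div (hs.pow 3) (pow_ne_zero 3 h1))).sub
    ((hm.div hs h1).pow 2)).add ((hs.log h1).const_mul 2)
  refine this.congr_deriv ?_
  simp only [Pi.pow_apply, Pi.neg_apply, Pi.div_apply, Nat.cast_ofNat,
    Nat.add_one_sub_one, pow_one]
  field_simp
  ring

lemma continuousOn_logRatioPrimitive : ContinuousOn logRatioPrimitive (Set.Icc 0 1) := by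
  have h1 : ∀ t ∈ Set.Icc (0 : ℝ) 1, 1 + t ≠ 0 := fun t ht => by linarith [ht.1]
  unfold logRatioPrimitive
  refine ((Real.continuous_mul_log.neg.continuousOn.mul
    (ContinuousOn.div (by fun_prop) (by fun_prop) fun t ht => pow_ne_zero 3 (h1 t ht))).sub
    ((ContinuousOn.div (by fun_prop) (by fun_prop) h1).pow 2)).add
    (continuousOn_const.mul (ContinuousOn.log (by fun_prop) h1))

lemma neg_log_mul_sq_nonneg {t : ℝ} (ht : t ∈ Set.Ioo (0 : ℝ) 1) :
    0 ≤ -Real.log t * (1 - t) ^ 2 :=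
  mul_nonneg (neg_nonneg.2 (Real.log_nonpos ht.1.le ht.2.le)) (sq_nonneg _)

lemma integrableOn_log_ratio :
    IntegrableOn (fun t : ℝ => -Real.log t * (1 - t) ^ 2 * (6 / (1 + t) ^ 4))
      (Set.Ioc 0 1) :=
  intervalIntegral.integrableOn_deriv_of_nonneg continuousOn_logRatioPrimitive
    (fun t ht => hasDerivAt_logRatioPrimitive ht.1)
    (fun t ht => mul_nonneg (neg_log_mul_sq_nonneg ht) (by positivity))

lemma integral_log_ratio :
    ∫ t in Set.Ioo (0 : ℝ) 1, -Real.log t * (1 - t) ^ 2 * (6 / (1 + t) ^ 4)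
      = 1 + 2 * Real.log 2 := by
  rw [← integral_Ioc_eq_integral_Ioo, ← intervalIntegral.integral_of_le zero_le_one,
    intervalIntegral.integral_eq_sub_of_hasDerivAt_of_le zero_le_one
      continuousOn_logRatioPrimitive (fun t ht => hasDerivAt_logRatioPrimitive ht.1)
      ((intervalIntegrable_iff_integrableOn_Ioc_of_le zero_le_one).2 integrableOn_log_ratio)]
  norm_num [logRatioPrimitive]
  ring

/-- The substitution `γ₁ = γ₀ t` in the inner integral. -/
lemma inner_integral_eq {x : ℝ} (hx : 0 < x) :
    (∫ y in Set.Ioo (0 : ℝ) x, Real.log (x / y) * (Real.exp (-(x + y)) * (x - y) ^ 2))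
      = ∫ t in Set.Ioo (0 : ℝ) 1,
          -Real.log t * (1 - t) ^ 2 * (x ^ 3 * Real.exp (-((1 + t) * x))) := by
  rw [← integral_Ioc_eq_integral_Ioo, ← integral_Ioc_eq_integral_Ioo,
    ← intervalIntegral.integral_of_le hx.le, ← intervalIntegral.integral_of_le zero_le_one]
  have h := intervalIntegral.smul_integral_comp_mul_left (a := 0) (b := 1)
    (fun y => Real.log (x / y) * (Real.exp (-(x + y)) * (x - y) ^ 2)) x
  rw [mul_zero, mul_one] at h
  rw [← h, ← intervalIntegral.integral_smul]
  refine intervalIntegral.integral_congr fun t _ => ?_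
  have hl : Real.log (x / (x * t)) = -Real.log t := by
    rw [← Real.log_inv, div_mul_cancel_left₀ hx.ne']
  simp only [hl, smul_eq_mul]
  rw [show -(x + x * t) = -((1 + t) * x) by ring]
  ring

lemma integrable_log_ratio_kernel :
    Integrable (Function.uncurry fun x t : ℝ =>
        -Real.log t * (1 - t) ^ 2 * (x ^ 3 * Real.exp (-((1 + t) * x))))
      ((volume.restrict (Set.Ioi (0 : ℝ))).prod (volume.restrict (Set.Ioo (0 : ℝ) 1))) := by
  have hmeas : Measurable (Function.uncurry fun x t : ℝ =>
      -Real.log t * (1 - t) ^ 2 * (x ^ 3 * Real.exp (-((1 + t) * x)))) := by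
    unfold Function.uncurry
    fun_prop
  refine (integrable_prod_iff' hmeas.aestronglyMeasurable).2 ⟨?_, ?_⟩
  · simp only [Function.uncurry_apply_pair]
    refine (ae_restrict_iff' measurableSet_Ioo).2 (.of_forall fun t ht => ?_)
    exact (integrableOn_pow_three_mul_exp_neg_mul
      (by linarith [ht.1] : 0 < 1 + t)).const_mul (-Real.log t * (1 - t) ^ 2)
  · refine (integrableOn_log_ratio.mono_set Set.Ioo_subset_Ioc_self).congr_fun (fun t ht => ?_)
      measurableSet_Ioo
    beta_reduce
    rw [← integral_pow_three_mul_exp_neg_mul (by linarith [ht.1] : 0 < 1 + t),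
      ← integral_const_mul]
    refine setIntegral_congr_fun measurableSet_Ioi fun x hx => ?_
    have hx0 : (0 : ℝ) < x := hx
    exact (Real.norm_of_nonneg (mul_nonneg (neg_log_mul_sq_nonneg ht) (by positivity))).symm

/-- For the joint density `e^{−(γ₀+γ₁)}(γ₀−γ₁)²` of the ordered eigenvalues of
a 2×2 complex Wishart matrix on `γ₀ > γ₁ > 0`, one has
`∫₀^∞ ∫₀^{γ₀} log(γ₀/γ₁) e^{−(γ₀+γ₁)}(γ₀−γ₁)² dγ₁ dγ₀ = 1 + 2 ln 2`. -/
theorem stmt17 :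
    ∫ g₀ in Set.Ioi (0 : ℝ),
      (∫ g₁ in Set.Ioo (0 : ℝ) g₀,
        Real.log (g₀ / g₁) * (Real.exp (-(g₀ + g₁)) * (g₀ - g₁) ^ 2))
      = 1 + 2 * Real.log 2 := by
  rw [setIntegral_congr_fun measurableSet_Ioi fun x hx => inner_integral_eq hx,
    integral_integral_swap integrable_log_ratio_kernel, ← integral_log_ratio]
  refine setIntegral_congr_fun measurableSet_Ioo fun t ht => ?_
  simp only [integral_const_mul]
  rw [integral_pow_three_mul_exp_neg_mul (by linarith [ht.1])]
end
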